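/- Let b, c, d, e, g ∈ ℂ with e, g, 1+e−g, 2−g all not equal to a nonpositive integer, and suppose g is not an integer. Then the two functions on D = {(x,y) ∈ ℝ² : 0 < x < 1, 0 < y} given by u₁(x,y) = F2(b,c,d;e;g;x,y) and u₂(x,y) = y^{1−g}·F2(b, c, 1+d−g; 1+e−g; 2−g; x, y) are linearly independent over ℂ: if α·u₁ + β·u₂ vanishes identically on D for α, β ∈ ℂ, then α = β = 0. -/

import Mathlib

noncomputable def poch (a : ℂ) (n : ℕ) : ℂ := ∏ i ∈ Finset.range n, (a + i)

/-- Kampé de Fériet function of the third order. -/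
noncomputable def F2 (b c d e g x y : ℂ) : ℂ :=
  ∑' p : ℕ × ℕ,
    poch b p.1 * poch c p.1 * poch d p.2 /
      (poch e (p.1 + p.2) * poch g p.2 * (Nat.factorial p.1 : ℂ) * (Nat.factorial p.2 : ℂ)) *
      x ^ p.1 * y ^ p.2

open Filter Topology

theorem norm_poch_le (a : ℂ) (n : ℕ) : ‖poch a n‖ ≤ (1 + ‖a‖) ^ n * (n.factorial : ℝ) := by
  induction n with
  | zero => simp [poch]
  | succ n ih =>
    have hstep : ‖a + n‖ ≤ (1 + ‖a‖) * ((n : ℝ) + 1) := by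
      have h1 := norm_add_le a (n : ℂ)
      rw [Complex.norm_natCast] at h1
      nlinarith [norm_nonneg a, mul_nonneg (norm_nonneg a) (Nat.cast_nonneg (α := ℝ) n)]
    have hsucc : poch a (n + 1) = poch a n * (a + n) := Finset.prod_range_succ _ _
    rw [hsucc, norm_mul, pow_succ, Nat.factorial_succ]
    push_cast
    calc ‖poch a n‖ * ‖a + n‖
        ≤ ((1 + ‖a‖) ^ n * (n.factorial : ℝ)) * ((1 + ‖a‖) * ((n : ℝ) + 1)) := by gcongr
      _ = _ := by ring

/-- Away from the nonpositive integers the factors of the Pochhammer symbol stay comparable with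
those of the factorial. -/
theorem exists_mul_succ_le_norm_add (a : ℂ) (ha : ∀ n : ℕ, a ≠ -(n : ℂ)) :
    ∃ δ : ℝ, 0 < δ ∧ ∀ n : ℕ, δ * ((n : ℝ) + 1) ≤ ‖a + n‖ := by
  have hpos : ∀ n : ℕ, 0 < ‖a + n‖ := fun n =>
    norm_pos_iff.2 fun h0 => ha n (eq_neg_of_add_eq_zero_left h0)
  obtain ⟨N, hN⟩ := exists_nat_ge (2 * ‖a‖ + 1)
  have hfin : ∀ M : ℕ, ∃ δ : ℝ, 0 < δ ∧ ∀ n < M, δ * ((n : ℝ) + 1) ≤ ‖a + n‖ := by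
    intro M
    induction M with
    | zero => exact ⟨1, one_pos, fun n hn => absurd hn (Nat.not_lt_zero n)⟩
    | succ M ih =>
      obtain ⟨δ, hδ, hle⟩ := ih
      have hM : (0 : ℝ) < (M : ℝ) + 1 := by positivity
      refine ⟨min δ (‖a + M‖ / ((M : ℝ) + 1)), lt_min hδ (div_pos (hpos M) hM), ?_⟩
      intro n hn
      rcases Nat.lt_succ_iff_lt_or_eq.1 hn with hlt | rfl
      · exact le_trans (by gcongr; exact min_le_left _ _) (hle n hlt)
      · rw [← le_div_iff₀ hM]
        exact min_le_right _ _
  obtain ⟨δ, hδ, hle⟩ := hfin N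
  refine ⟨min δ (1 / 4), lt_min hδ (by norm_num), fun n => ?_⟩
  rcases lt_or_ge n N with hlt | hge
  · exact le_trans (by gcongr; exact min_le_left _ _) (hle n hlt)
  · have hcast : (N : ℝ) ≤ n := by exact_mod_cast hge
    have htri : (n : ℝ) ≤ ‖a + n‖ + ‖a‖ := by
      have h1 := norm_sub_le (a + n) a
      rwa [add_sub_cancel_left, Complex.norm_natCast] at h1
    have hquarter : min δ (1 / 4) * ((n : ℝ) + 1) ≤ 1 / 4 * ((n : ℝ) + 1) := by
      gcongr
      exact min_le_right _ _
    linarith [norm_nonneg a]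

theorem exists_pow_mul_factorial_le_norm_poch (a : ℂ) (ha : ∀ n : ℕ, a ≠ -(n : ℂ)) :
    ∃ δ : ℝ, 0 < δ ∧ ∀ n : ℕ, δ ^ n * (n.factorial : ℝ) ≤ ‖poch a n‖ := by
  obtain ⟨δ, hδ, hle⟩ := exists_mul_succ_le_norm_add a ha
  refine ⟨δ, hδ, fun n => ?_⟩
  induction n with
  | zero => simp [poch]
  | succ n ih =>
    have hsucc : poch a (n + 1) = poch a n * (a + n) := Finset.prod_range_succ _ _
    rw [hsucc, norm_mul, pow_succ, Nat.factorial_succ]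
    push_cast
    calc δ ^ n * δ * (((n : ℝ) + 1) * (n.factorial : ℝ))
        = (δ ^ n * (n.factorial : ℝ)) * (δ * ((n : ℝ) + 1)) := by ring
      _ ≤ ‖poch a n‖ * ‖a + n‖ := by
        gcongr
        exact hle n

theorem exists_norm_coeff_F2_le (b c d e g : ℂ)
    (he : ∀ n : ℕ, e ≠ -(n : ℂ)) (hg : ∀ n : ℕ, g ≠ -(n : ℂ)) :
    ∃ A B : ℝ, 0 < A ∧ 0 < B ∧ ∀ m n : ℕ,
      ‖poch b m * poch c m * poch d n /
        (poch e (m + n) * poch g n * (Nat.factorial m : ℂ) * (Nat.factorial n : ℂ))‖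
        ≤ A ^ m * B ^ n := by
  obtain ⟨δ, hδ, hle⟩ := exists_pow_mul_factorial_le_norm_poch e he
  obtain ⟨γ, hγ, hleg⟩ := exists_pow_mul_factorial_le_norm_poch g hg
  refine ⟨(1 + ‖b‖) * (1 + ‖c‖) / δ, (1 + ‖d‖) / (δ * γ), by positivity, by positivity,
    fun m n => ?_⟩
  have hm : (0 : ℝ) < m.factorial := by exact_mod_cast m.factorial_pos
  have hn : (1 : ℝ) ≤ n.factorial := by exact_mod_cast n.factorial_pos
  have hmn : (m.factorial : ℝ) * n.factorial ≤ (m + n).factorial := by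
    exact_mod_cast Nat.le_of_dvd (Nat.factorial_pos _)
      (Nat.factorial_mul_factorial_dvd_factorial_add m n)
  rw [norm_div]
  simp only [norm_mul, Complex.norm_natCast]
  calc ‖poch b m‖ * ‖poch c m‖ * ‖poch d n‖ /
        (‖poch e (m + n)‖ * ‖poch g n‖ * (m.factorial : ℝ) * (n.factorial : ℝ))
      ≤ ((1 + ‖b‖) ^ m * (m.factorial : ℝ)) * ((1 + ‖c‖) ^ m * (m.factorial : ℝ)) *
          ((1 + ‖d‖) ^ n * (n.factorial : ℝ)) /
        ((δ ^ (m + n) * ((m.factorial : ℝ) * n.factorial)) * (γ ^ n * 1) *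
          (m.factorial : ℝ) * 1) := by
        have hE : δ ^ (m + n) * ((m.factorial : ℝ) * n.factorial) ≤ ‖poch e (m + n)‖ :=
          le_trans (by gcongr) (hle (m + n))
        have hG : γ ^ n * 1 ≤ ‖poch g n‖ := le_trans (by gcongr) (hleg n)
        gcongr
        · exact norm_poch_le b m
        · exact norm_poch_le c m
        · exact norm_poch_le d n
    _ = _ := by
        have hn0 : (n.factorial : ℝ) ≠ 0 := by positivity
        simp only [div_pow, mul_pow, pow_add]
        field_simp

theorem tendsto_F2_diagonal (b c d e g : ℂ)
    (he : ∀ n : ℕ, e ≠ -(n : ℂ)) (hg : ∀ n : ℕ, g ≠ -(n : ℂ)) :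
    Tendsto (fun z : ℂ => F2 b c d e g z z) (𝓝 0) (𝓝 1) := by
  obtain ⟨A, B, hA, hB, hle⟩ := exists_norm_coeff_F2_le b c d e g he hg
  have hzero : F2 b c d e g 0 0 = 1 := by
    unfold F2
    rw [tsum_eq_single ((0, 0) : ℕ × ℕ)]
    · simp [poch]
    · rintro ⟨m, n⟩ hmn
      rcases Nat.eq_zero_or_pos m with rfl | hm
      · have hn : n ≠ 0 := fun h0 => hmn (by rw [h0])
        simp [hn]
      · simp [hm.ne']
  rw [← hzero]
  have hgeom : Summable fun n : ℕ => ((1 : ℝ) / 2) ^ n := summable_geometric_two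
  refine tendsto_tsum_of_dominated_convergence
    (bound := fun p : ℕ × ℕ => ((1 : ℝ) / 2) ^ p.1 * (1 / 2) ^ p.2)
    (hgeom.mul_of_nonneg hgeom (fun n => by positivity) (fun n => by positivity)) ?_ ?_
  · intro p
    exact Continuous.tendsto (by fun_prop) (0 : ℂ)
  · have hAz : ∀ᶠ z : ℂ in 𝓝 0, A * ‖z‖ < 1 / 2 :=
      (by fun_prop : Continuous fun z : ℂ => A * ‖z‖).tendsto' 0 0 (by simp)
        |>.eventually_lt_const (by norm_num)
    have hBz : ∀ᶠ z : ℂ in 𝓝 0, B * ‖z‖ < 1 / 2 :=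
      (by fun_prop : Continuous fun z : ℂ => B * ‖z‖).tendsto' 0 0 (by simp)
        |>.eventually_lt_const (by norm_num)
    filter_upwards [hAz, hBz] with z hAz hBz p
    rw [norm_mul, norm_mul, norm_pow, norm_pow]
    calc _ ≤ A ^ p.1 * B ^ p.2 * ‖z‖ ^ p.1 * ‖z‖ ^ p.2 := by
          gcongr
          exact hle p.1 p.2
      _ = (A * ‖z‖) ^ p.1 * (B * ‖z‖) ^ p.2 := by ring
      _ ≤ _ := by gcongr

/-- A complex power with nonzero exponent has no nonzero limit at `0`. -/
theorem eq_zero_of_tendsto_exp_mul_log {w L : ℂ} (hL : L ≠ 0)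
    (hlim : Tendsto (fun t : ℝ => Complex.exp (w * (Real.log t : ℂ))) (𝓝[>] 0) (𝓝 L)) :
    w = 0 := by
  have hone : ∀ s : ℝ, Complex.exp (w * s) = 1 := by
    intro s
    have hscale : Tendsto (fun t : ℝ => Real.exp s * t) (𝓝[>] 0) (𝓝[>] 0) := by
      refine tendsto_nhdsWithin_iff.2 ⟨?_, ?_⟩
      · exact ((by fun_prop : Continuous fun t : ℝ => Real.exp s * t).tendsto' 0 0
          (by simp)).mono_left nhdsWithin_le_nhds
      · filter_upwards [self_mem_nhdsWithin] with t ht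
        exact mul_pos (Real.exp_pos s) ht
    have hscaled : Tendsto (fun t : ℝ => Complex.exp (w * (Real.log t : ℂ))) (𝓝[>] 0)
        (𝓝 (Complex.exp (-(w * s)) * L)) := by
      refine ((hlim.comp hscale).const_mul (Complex.exp (-(w * s)))).congr' ?_
      filter_upwards [self_mem_nhdsWithin] with t ht
      have ht' : t ≠ 0 := ne_of_gt ht
      rw [Function.comp_apply, Real.log_mul (Real.exp_pos s).ne' ht', Real.log_exp,
        ← Complex.exp_add]
      push_cast
      ring_nf
    have heq : Complex.exp (-(w * s)) = 1 :=
      mul_right_cancel₀ hL ((tendsto_nhds_unique hscaled hlim).trans (one_mul L).symm)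
    rwa [Complex.exp_neg, inv_eq_one] at heq
  have hderiv : HasDerivAt (fun s : ℝ => Complex.exp (w * s)) w 0 := by
    have h1 := (Complex.ofRealCLM.hasDerivAt (x := (0 : ℝ))).const_mul w
    simpa using h1.cexp
  have hconst : (fun s : ℝ => Complex.exp (w * s)) = fun _ => 1 := funext hone
  rw [hconst] at hderiv
  exact hderiv.unique (hasDerivAt_const 0 1)

theorem stmt11 (b c d e g : ℂ)
    (he : ∀ n : ℕ, e ≠ -(n : ℂ)) (hg : ∀ n : ℕ, g ≠ -(n : ℂ))
    (he' : ∀ n : ℕ, (1 + e - g) ≠ -(n : ℂ)) (hg' : ∀ n : ℕ, (2 - g) ≠ -(n : ℂ))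
    (hgint : ∀ n : ℤ, g ≠ (n : ℂ))
    (α β : ℂ)
    (h : ∀ x y : ℝ, 0 < x → x < 1 → 0 < y →
      α * F2 b c d e g (x : ℂ) (y : ℂ)
        + β * (Complex.exp ((1 - g) * (Real.log y : ℂ)) *
            F2 b c (1 + d - g) (1 + e - g) (2 - g) (x : ℂ) (y : ℂ))
        = 0) :
    α = 0 ∧ β = 0 := by
  have hcoe : Tendsto (fun t : ℝ => (t : ℂ)) (𝓝[>] 0) (𝓝 0) :=
    (Complex.continuous_ofReal.tendsto' 0 0 Complex.ofReal_zero).mono_left nhdsWithin_le_nhds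
  have hu := (tendsto_F2_diagonal b c d e g he hg).comp hcoe
  have hv := (tendsto_F2_diagonal b c (1 + d - g) (1 + e - g) (2 - g) he' hg').comp hcoe
  have hlt : ∀ᶠ t : ℝ in 𝓝[>] 0, 0 < t ∧ t < 1 := Ioo_mem_nhdsGT one_pos
  have hβ : β = 0 := by
    by_contra hβ
    have hlim : Tendsto (fun t : ℝ => Complex.exp ((1 - g) * (Real.log t : ℂ))) (𝓝[>] 0)
        (𝓝 (-(α / β))) := by
      have hquot := (hu.div hv one_ne_zero).const_mul (-(α / β))
      rw [div_one, mul_one] at hquot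
      refine hquot.congr' ?_
      filter_upwards [hlt, hv.eventually_ne one_ne_zero] with t ht hne
      have hrel := h t t ht.1 ht.2 ht.1
      simp only [Function.comp_apply, Pi.div_apply] at hne ⊢
      field_simp
      linear_combination -hrel
    by_cases hα : α = 0
    · obtain ⟨t, ht, hne⟩ := (hlt.and (hv.eventually_ne one_ne_zero)).exists
      have hrel := h t t ht.1 ht.2 ht.1
      rw [hα, zero_mul, zero_add] at hrel
      exact mul_ne_zero hβ (mul_ne_zero (Complex.exp_ne_zero _) hne) hrel
    · have hw := eq_zero_of_tendsto_exp_mul_log (neg_ne_zero.2 (div_ne_zero hα hβ)) hlim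
      exact hgint 1 (by push_cast; exact (sub_eq_zero.1 hw).symm)
  obtain ⟨t, ht, hne⟩ := (hlt.and (hu.eventually_ne one_ne_zero)).exists
  have hrel := h t t ht.1 ht.2 ht.1
  rw [hβ, zero_mul, add_zero] at hrel
  exact ⟨(mul_eq_zero.1 hrel).resolve_right hne, hβ⟩
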